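/- Fix ε > 0 and F ∈ (1, ∞). Let p, q ∈ [2, ∞) and s ∈ ℝ, and suppose there exists a constant C > 0 such that for every Schwartz function g on ℝ³ the function u(t,x) = ∫_{ℝ³} exp(i x·ξ + i (t/ε) p_F(ξ)) ĝ(ξ) dξ satisfies ‖u‖_{L^p_t L^q_x} ≤ C ‖g‖_{Ḣˢ}. Then necessarily 2/p + 1/q ≤ 1/2 and s = 3(1/2 − 1/q). -/

import Mathlib

open MeasureTheory Complex
open scoped ENNReal RealInnerProductSpace

noncomputable section

/-- Fourier transform `f̂(ξ) = ∫ e^{-i x·ξ} f(x) dx` on `ℝⁿ`. -/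
def fourierTf {n : ℕ} (f : EuclideanSpace ℝ (Fin n) → ℂ) (ξ : EuclideanSpace ℝ (Fin n)) : ℂ :=
  ∫ x : EuclideanSpace ℝ (Fin n), Complex.exp (-Complex.I * Complex.ofReal ⟪x, ξ⟫) * f x

/-- Homogeneous Sobolev norm `‖f‖_{Ḣˢ}` on `ℝⁿ`. -/
def sobolevNorm {n : ℕ} (s : ℝ) (f : EuclideanSpace ℝ (Fin n) → ℂ) : ℝ :=
  (∫ ξ : EuclideanSpace ℝ (Fin n), ‖ξ‖ ^ (2 * s) * ‖fourierTf f ξ‖ ^ 2) ^ (1 / 2 : ℝ)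

/-- The dispersion relation `p_F(ξ) = |ξ|_F / (F |ξ|)`. -/
def pF (F : ℝ) (ξ : EuclideanSpace ℝ (Fin 3)) : ℝ :=
  Real.sqrt ((ξ 0) ^ 2 + (ξ 1) ^ 2 + (F * ξ 2) ^ 2) / (F * ‖ξ‖)

/-- Mixed space-time norm `‖u‖_{L^p_t L^q_x}` (as an extended nonneg real). -/
def mixedNorm (p q : ℝ) (u : ℝ → EuclideanSpace ℝ (Fin 3) → ℂ) : ℝ≥0∞ :=
  (∫⁻ t : ℝ, (∫⁻ x : EuclideanSpace ℝ (Fin 3), (‖u t x‖₊ : ℝ≥0∞) ^ q) ^ (p / q)) ^ (1 / p)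

/-- A coordinate box in `ℝ³`. -/
def sbox (c r : Fin 3 → ℝ) : Set (EuclideanSpace ℝ (Fin 3)) := {x | ∀ i, |x i - c i| ≤ r i}

lemma sbox_eq (c r : Fin 3 → ℝ) : sbox c r =
    (WithLp.ofLp : EuclideanSpace ℝ (Fin 3) → (Fin 3 → ℝ)) ⁻¹'
      (Set.Icc (fun i => c i - r i) (fun i => c i + r i)) := by
  ext x
  simp only [sbox, Set.mem_ofPred_eq, Set.mem_preimage, Set.mem_Icc, Pi.le_def, ← forall_and]
  refine forall_congr' fun i => ?_
  rw [abs_le]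
  constructor <;> rintro ⟨h1, h2⟩ <;> constructor <;> linarith

lemma sbox_meas (c r : Fin 3 → ℝ) : MeasurableSet (sbox c r) := by
  rw [sbox_eq]
  exact (PiLp.volume_preserving_ofLp (Fin 3)).measurable measurableSet_Icc

lemma sbox_vol (c r : Fin 3 → ℝ) :
    volume (sbox c r) = ENNReal.ofReal (2 * r 0) * ENNReal.ofReal (2 * r 1)
      * ENNReal.ofReal (2 * r 2) := by
  rw [sbox_eq, (PiLp.volume_preserving_ofLp (Fin 3)).measure_preimage
    measurableSet_Icc.nullMeasurableSet, Real.volume_Icc_pi, Fin.prod_univ_three]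
  have e : ∀ i, c i + r i - (c i - r i) = 2 * r i := fun i => by ring
  simp only [e]

lemma exists_bump (c r : ℝ) (hr : 0 < r) : ∃ b : ℝ → ℝ, ContDiff ℝ (⊤ : ℕ∞) b ∧
    (∀ x, 0 ≤ b x) ∧ (∀ x, b x ≤ 1) ∧ (∀ x, |x - c| ≤ r / 2 → b x = 1) ∧
    (∀ x, r < |x - c| → b x = 0) := by
  let f : ContDiffBump c := ⟨r / 2, r, by linarith, by linarith⟩
  refine ⟨f, f.contDiff, fun x => f.nonneg, fun x => f.le_one, fun x hx => ?_, fun x hx => ?_⟩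
  · exact f.one_of_mem_closedBall (by simpa [Real.dist_eq] using hx)
  · exact f.zero_of_le_dist (by simpa [Real.dist_eq] using hx.le)

lemma exists_bump3 (c r : Fin 3 → ℝ) (hr : ∀ i, 0 < r i) :
    ∃ φ : EuclideanSpace ℝ (Fin 3) → ℝ, ContDiff ℝ (⊤ : ℕ∞) φ ∧ HasCompactSupport φ ∧
    (∀ x, 0 ≤ φ x) ∧ (∀ x, φ x ≤ 1) ∧ (∀ x ∈ sbox c (fun i => r i / 2), φ x = 1) ∧
    (∀ x ∉ sbox c r, φ x = 0) := by
  choose b hb h0 h1 hin hout using fun i => exists_bump (c i) (r i) (hr i)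
  have hz : ∀ x ∉ sbox c r, ∏ i, b i ((x : EuclideanSpace ℝ (Fin 3)) i) = 0 := by
    intro x hx
    simp only [sbox, Set.mem_ofPred_eq, not_forall, not_le] at hx
    obtain ⟨i, hi⟩ := hx
    exact Finset.prod_eq_zero (Finset.mem_univ i) (hout i _ hi)
  refine ⟨fun x => ∏ i, b i (x i), ?_, ?_, ?_, ?_, ?_, hz⟩
  · refine contDiff_prod fun i _ => (hb i).comp ?_
    fun_prop
  · have hc : IsCompact (sbox c r) := by
      rw [sbox_eq]
      exact (PiLp.homeomorph 2 (fun _ : Fin 3 => ℝ)).isCompact_preimage.2 isCompact_Icc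
    exact HasCompactSupport.intro hc hz
  · exact fun x => Finset.prod_nonneg fun i _ => h0 i _
  · exact fun x => Finset.prod_le_one (fun i _ => h0 i _) (fun i _ => h1 i _)
  · exact fun x hx => Finset.prod_eq_one fun i _ => hin i _ (hx i)

open FourierTransform in
lemma exists_schwartz (φ : EuclideanSpace ℝ (Fin 3) → ℝ) (hφ : ContDiff ℝ (⊤ : ℕ∞) φ)
    (hc : HasCompactSupport φ) : ∃ g : SchwartzMap (EuclideanSpace ℝ (Fin 3)) ℂ,
      ∀ ξ, fourierTf (fun y => g y) ξ = (φ ξ : ℂ) := by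
  have hpi : (2 * Real.pi) ≠ 0 := by positivity
  have h1 : HasCompactSupport (fun η : EuclideanSpace ℝ (Fin 3) => ((φ ((2 * Real.pi) • η) : ℝ) : ℂ)) := by
    have := (hc.comp_homeomorph (Homeomorph.smulOfNeZero (2 * Real.pi) hpi)).comp_left
      (g := Complex.ofReal) (by simp)
    exact this
  have h2 : ContDiff ℝ (⊤ : ℕ∞) (fun η : EuclideanSpace ℝ (Fin 3) => ((φ ((2 * Real.pi) • η) : ℝ) : ℂ)) := by
    refine Complex.ofRealCLM.contDiff.comp (hφ.comp ?_)
    fun_prop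
  let f := h1.toSchwartzMap h2
  refine ⟨𝓕⁻ f, fun ξ => ?_⟩
  have h3 : 𝓕 (𝓕⁻ f) = f := FourierTransform.fourier_fourierInv_eq f
  have h4 : (𝓕 (𝓕⁻ f)) ((2 * Real.pi)⁻¹ • ξ) = (φ ξ : ℂ) := by
    rw [h3]
    change ((φ ((2 * Real.pi) • ((2 * Real.pi)⁻¹ • ξ)) : ℝ) : ℂ) = _
    rw [smul_inv_smul₀ hpi]
  rw [← h4, SchwartzMap.fourier_coe, Real.fourier_eq', fourierTf]
  refine integral_congr_ae (Filter.Eventually.of_forall fun x => ?_)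
  simp only [smul_eq_mul, inner_smul_right]
  congr 2
  push_cast
  have : (Real.pi : ℂ) ≠ 0 := by exact_mod_cast Real.pi_ne_zero
  field_simp

lemma pF_bound (F δ l : ℝ) (hF : 1 < F) (hδ : 0 < δ) (hl : 0 < l) (ξ : EuclideanSpace ℝ (Fin 3))
    (hN : l / 2 ≤ ‖ξ‖) (hz : |ξ 2| ≤ l * δ / 2) :
    |pF F ξ - 1 / F| ≤ (F ^ 2 - 1) / (2 * F) * δ ^ 2 := by
  have hNpos : 0 < ‖ξ‖ := by linarith
  set N := ‖ξ‖ with hNdef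
  have hN2 : N ^ 2 = ξ 0 ^ 2 + ξ 1 ^ 2 + ξ 2 ^ 2 := by
    rw [hNdef, EuclideanSpace.norm_sq_eq, Fin.sum_univ_three]; simp
  have hz2 : ξ 2 ^ 2 ≤ N ^ 2 * δ ^ 2 := by
    rw [← mul_pow, ← sq_abs]
    refine pow_le_pow_left₀ (abs_nonneg _) (hz.trans ?_) 2
    nlinarith
  have hF1 : 0 < F ^ 2 - 1 := by nlinarith
  have hS1 : N ≤ Real.sqrt (ξ 0 ^ 2 + ξ 1 ^ 2 + (F * ξ 2) ^ 2) := by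
    apply Real.le_sqrt_of_sq_le
    nlinarith [mul_nonneg hF1.le (sq_nonneg (ξ 2))]
  have hS2 : Real.sqrt (ξ 0 ^ 2 + ξ 1 ^ 2 + (F * ξ 2) ^ 2) ≤ N + (F ^ 2 - 1) * N * δ ^ 2 / 2 := by
    apply Real.sqrt_le_iff.2 ⟨by positivity, ?_⟩
    have := mul_le_mul_of_nonneg_left hz2 hF1.le
    nlinarith [sq_nonneg ((F ^ 2 - 1) * N * δ ^ 2 / 2)]
  have hFp : 0 < F := by linarith
  have e : pF F ξ - 1 / F = (Real.sqrt (ξ 0 ^ 2 + ξ 1 ^ 2 + (F * ξ 2) ^ 2) - N) / (F * N) := by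
    rw [pF, ← hNdef]; field_simp
  rw [e, abs_of_nonneg (div_nonneg (by linarith) (by positivity)), div_le_iff₀ (by positivity)]
  have : (F ^ 2 - 1) / (2 * F) * δ ^ 2 * (F * N) = (F ^ 2 - 1) * N * δ ^ 2 / 2 := by
    field_simp
  linarith

lemma osc_lower (φ θ : EuclideanSpace ℝ (Fin 3) → ℝ) (θ0 : ℝ) (hφi : Integrable φ)
    (hθ : Measurable θ) (h0 : ∀ ξ, 0 ≤ φ ξ) (B : Set (EuclideanSpace ℝ (Fin 3)))
    (hB : MeasurableSet B) (hBf : volume B ≠ ⊤) (h1 : ∀ ξ ∈ B, φ ξ = 1)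
    (hph : ∀ ξ, φ ξ ≠ 0 → |θ ξ - θ0| ≤ 1) :
    volume.real B / 2 ≤ ‖∫ ξ, Complex.exp (Complex.I * Complex.ofReal (θ ξ)) * (φ ξ : ℂ)‖ := by
  have hn : ∀ a : ℝ, ‖Complex.exp (Complex.I * Complex.ofReal a)‖ = 1 := fun a => by
    rw [mul_comm]; exact Complex.norm_exp_ofReal_mul_I a
  have hi : Integrable (fun ξ => Complex.exp (Complex.I * Complex.ofReal (θ ξ - θ0)) * (φ ξ : ℂ)) := by
    refine Integrable.bdd_mul (c := 1) hφi.ofReal ?_ (Filter.Eventually.of_forall fun x => ?_)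
    · exact Measurable.aestronglyMeasurable (by fun_prop)
    · exact_mod_cast (hn (θ x - θ0)).le
  have e : (∫ ξ, Complex.exp (Complex.I * Complex.ofReal (θ ξ)) * (φ ξ : ℂ)) =
      Complex.exp (Complex.I * Complex.ofReal θ0) *
      ∫ ξ, Complex.exp (Complex.I * Complex.ofReal (θ ξ - θ0)) * (φ ξ : ℂ) := by
    rw [← integral_const_mul]
    refine integral_congr_ae (Filter.Eventually.of_forall fun x => ?_)
    simp only
    rw [← mul_assoc, ← Complex.exp_add]
    congr 2
    push_cast
    ring
  rw [e, norm_mul, hn, one_mul]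
  refine le_trans ?_ ((le_abs_self _).trans (Complex.abs_re_le_norm _))
  have hre := integral_re hi
  simp only [RCLike.re_to_complex] at hre
  rw [← hre]
  have e2 : volume.real B / 2 = ∫ ξ, B.indicator (fun _ => (1/2 : ℝ)) ξ := by
    rw [integral_indicator hB, setIntegral_const, smul_eq_mul]; ring
  rw [e2]
  refine integral_mono ((integrable_indicator_iff hB).2 (integrableOn_const hBf)) hi.re ?_
  intro ξ
  have e3 : (Complex.exp (Complex.I * Complex.ofReal (θ ξ - θ0)) * (φ ξ : ℂ)).re
      = Real.cos (θ ξ - θ0) * φ ξ := by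
    rw [Complex.re_mul_ofReal, mul_comm Complex.I, Complex.exp_ofReal_mul_I_re]
  have e3' : (Complex.exp (Complex.I * ((θ ξ : ℂ) - (θ0 : ℂ))) * (φ ξ : ℂ)).re
      = Real.cos (θ ξ - θ0) * φ ξ := by
    rw [← e3]; push_cast; rfl
  have key : φ ξ / 2 ≤ Real.cos (θ ξ - θ0) * φ ξ := by
    by_cases h : φ ξ = 0
    · simp [h]
    have := hph ξ h
    have hc := Real.one_sub_sq_div_two_le_cos (x := θ ξ - θ0)
    have : (θ ξ - θ0) ^ 2 ≤ 1 := by rw [← sq_abs]; exact pow_le_one₀ (abs_nonneg _) this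
    nlinarith [h0 ξ]
  refine le_trans ?_ (key.trans e3.symm.le)
  by_cases h : ξ ∈ B
  · simp [h, h1 ξ h]
  · simp only [Set.indicator_of_notMem h]; linarith [h0 ξ]

lemma rpow_bound (s l x : ℝ) (hl : 0 < l) (h1 : l / 2 ≤ x) (h2 : x ≤ 2 * l) :
    x ^ (2 * s) ≤ Real.exp (Real.log 2 * |2 * s|) * l ^ (2 * s) := by
  have hx : 0 < x := by linarith
  rw [Real.rpow_def_of_pos hx, Real.rpow_def_of_pos hl, ← Real.exp_add]
  apply Real.exp_le_exp.2
  have a1 : Real.log x ≤ Real.log 2 + Real.log l := by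
    rw [← Real.log_mul (by norm_num) hl.ne']
    exact Real.log_le_log hx h2
  have a2 : Real.log l - Real.log 2 ≤ Real.log x := by
    rw [← Real.log_div hl.ne' (by norm_num)]
    exact Real.log_le_log (by linarith) h1
  have h3 : |Real.log x - Real.log l| ≤ Real.log 2 := abs_le.2 ⟨by linarith, by linarith⟩
  have h4 : (Real.log x - Real.log l) * (2 * s) ≤ Real.log 2 * |2 * s| := by
    refine (le_abs_self _).trans ?_
    rw [abs_mul]
    exact mul_le_mul_of_nonneg_right h3 (abs_nonneg _)
  linarith

lemma pF_measurable (F : ℝ) : Measurable (pF F) := by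
  unfold pF
  fun_prop

lemma main_ineq (ε F : ℝ) (hε : 0 < ε) (hF : 1 < F)
    (p q s C : ℝ) (hp : 2 ≤ p) (hq : 2 ≤ q) (hC : 0 < C)
    (h : ∀ g : SchwartzMap (EuclideanSpace ℝ (Fin 3)) ℂ,
      mixedNorm p q (fun t x =>
          ∫ ξ : EuclideanSpace ℝ (Fin 3),
            Complex.exp (Complex.I * Complex.ofReal (⟪x, ξ⟫ + (t / ε) * pF F ξ)) *
              fourierTf (fun y => g y) ξ)
        ≤ ENNReal.ofReal (C * sobolevNorm s (fun y => g y)))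
    (l δ A : ℝ) (hl : 0 < l) (hδ : 0 < δ) (hδ1 : δ ≤ 1) (hA : A = l ^ 3 * δ) :
    (((A / 16) ^ q * (A⁻¹ / 64)) ^ (p / q) * (2 * (ε * F / (F ^ 2 - 1) / δ ^ 2))) ^ (1 / p) ≤
      C * (Real.exp (Real.log 2 * |2 * s|) * l ^ (2 * s) * A) ^ (1 / 2 : ℝ) := by
  have hApos : 0 < A := by rw [hA]; positivity
  have hF1 : 0 < F ^ 2 - 1 := by nlinarith
  have hFp : 0 < F := by linarith
  have hp0 : 0 < p := by linarith
  have hq0 : 0 < q := by linarith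
  let c : Fin 3 → ℝ := ![l, 0, 0]
  let r : Fin 3 → ℝ := ![l / 2, l / 2, l * δ / 2]
  let rx : Fin 3 → ℝ := ![1 / (8 * l), 1 / (8 * l), 1 / (8 * (l * δ))]
  have hr : ∀ i, 0 < r i := by
    intro i; fin_cases i <;> simp [r] <;> positivity
  obtain ⟨φ, hφ, hcs, h0, h1, hin, hout⟩ := exists_bump3 c r hr
  obtain ⟨g, hg⟩ := exists_schwartz φ hφ hcs
  have hbd : ∀ ξ ∈ sbox c r, |ξ 0 - l| ≤ l / 2 ∧ |ξ 1| ≤ l / 2 ∧ |ξ 2| ≤ l * δ / 2 := by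
    intro ξ hξ
    refine ⟨?_, ?_, ?_⟩
    · simpa [c, r] using hξ 0
    · simpa [c, r] using hξ 1
    · simpa [c, r] using hξ 2
  have hvol : volume.real (sbox c r) = A := by
    rw [Measure.real, sbox_vol, ENNReal.toReal_mul, ENNReal.toReal_mul,
      ENNReal.toReal_ofReal (by linarith [hr 0]), ENNReal.toReal_ofReal (by linarith [hr 1]),
      ENNReal.toReal_ofReal (by linarith [hr 2])]
    simp [r, hA]; ring
  have hvol2 : volume.real (sbox c (fun i => r i / 2)) = A / 8 := by
    rw [Measure.real, sbox_vol, ENNReal.toReal_mul, ENNReal.toReal_mul,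
      ENNReal.toReal_ofReal (by linarith [hr 0]), ENNReal.toReal_ofReal (by linarith [hr 1]),
      ENNReal.toReal_ofReal (by linarith [hr 2])]
    simp [r, hA]; ring
  have hfin : ∀ c r, volume (sbox c r) < ⊤ := by
    intro c r
    rw [sbox_vol]
    exact ENNReal.mul_lt_top (ENNReal.mul_lt_top ENNReal.ofReal_lt_top ENNReal.ofReal_lt_top)
      ENNReal.ofReal_lt_top
  have hvolx : volume (sbox 0 rx) = ENNReal.ofReal (A⁻¹ / 64) := by
    rw [sbox_vol, ← ENNReal.ofReal_mul (by simp [rx]; positivity),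
      ← ENNReal.ofReal_mul (by simp [rx]; positivity)]
    congr 1
    simp [rx, hA]; field_simp; norm_num
  have hNl : ∀ ξ ∈ sbox c r, l / 2 ≤ ‖ξ‖ := by
    intro ξ hξ
    obtain ⟨b0, b1, b2⟩ := hbd ξ hξ
    have := PiLp.norm_apply_le ξ 0
    rw [Real.norm_eq_abs] at this
    have := le_abs_self (ξ 0)
    have := (abs_le.1 b0).1
    linarith
  have hNu : ∀ ξ ∈ sbox c r, ‖ξ‖ ≤ 2 * l := by
    intro ξ hξ
    obtain ⟨b0, b1, b2⟩ := hbd ξ hξ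
    have hN2 : ‖ξ‖ ^ 2 = ξ 0 ^ 2 + ξ 1 ^ 2 + ξ 2 ^ 2 := by
      rw [EuclideanSpace.norm_sq_eq, Fin.sum_univ_three]; simp
    have b2' : |ξ 2| ≤ l / 2 := b2.trans (by nlinarith)
    have d0 := abs_le.1 b0
    have d1 := abs_le.1 b1
    have d2 := abs_le.1 b2'
    refine le_of_sq_le_sq ?_ (by positivity)
    rw [hN2]
    nlinarith
  -- upper bound for the Sobolev norm
  have hsob : sobolevNorm s (fun y => g y) ≤
      (Real.exp (Real.log 2 * |2 * s|) * l ^ (2 * s) * A) ^ (1 / 2 : ℝ) := by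
    unfold sobolevNorm
    refine Real.rpow_le_rpow (integral_nonneg fun ξ => by positivity) ?_ (by norm_num)
    simp only [hg]
    rw [← setIntegral_eq_integral_of_forall_compl_eq_zero (s := sbox c r)
      (fun ξ hξ => by simp [hout ξ hξ])]
    refine (le_abs_self _).trans ?_
    rw [← Real.norm_eq_abs, ← hvol]
    refine norm_setIntegral_le_of_norm_le_const (hfin _ _) fun ξ hξ => ?_
    rw [Real.norm_eq_abs, abs_of_nonneg (by positivity)]
    have e1 := rpow_bound s l ‖ξ‖ hl (hNl ξ hξ) (hNu ξ hξ)
    have e2 : ‖((φ ξ : ℝ) : ℂ)‖ ^ 2 ≤ 1 := by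
      rw [Complex.norm_real, Real.norm_eq_abs, abs_of_nonneg (h0 ξ)]
      exact pow_le_one₀ (h0 ξ) (h1 ξ)
    calc _ ≤ (Real.exp (Real.log 2 * |2 * s|) * l ^ (2 * s)) * 1 :=
          mul_le_mul e1 e2 (by positivity) (by positivity)
      _ = _ := mul_one _
  -- pointwise lower bound
  have hpt : ∀ t : ℝ, |t| ≤ ε * F / (F ^ 2 - 1) / δ ^ 2 → ∀ x ∈ sbox 0 rx,
      A / 16 ≤ ‖∫ ξ : EuclideanSpace ℝ (Fin 3),
            Complex.exp (Complex.I * Complex.ofReal (⟪x, ξ⟫ + (t / ε) * pF F ξ)) *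
              fourierTf (fun y => g y) ξ‖ := by
    intro t ht x hx
    simp only [hg]
    have hφi : Integrable φ := hφ.continuous.integrable_of_hasCompactSupport hcs
    have hm : Measurable fun ξ : EuclideanSpace ℝ (Fin 3) => ⟪x, ξ⟫ + (t / ε) * pF F ξ := by
      have := pF_measurable F
      fun_prop
    have key := osc_lower φ (fun ξ => ⟪x, ξ⟫ + (t / ε) * pF F ξ) (t / ε * (1 / F)) hφi hm h0
      (sbox c (fun i => r i / 2)) (sbox_meas _ _) (hfin _ _).ne hin ?_
    · rw [hvol2] at key
      refine le_trans (le_of_eq (by ring)) key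
    intro ξ hξ
    have hξ' : ξ ∈ sbox c r := by
      by_contra hcon
      exact hξ (hout ξ hcon)
    obtain ⟨b0, b1, b2⟩ := hbd ξ hξ'
    have x0 : |x 0| ≤ 1 / (8 * l) := by simpa [rx] using hx 0
    have x1 : |x 1| ≤ 1 / (8 * l) := by simpa [rx] using hx 1
    have x2 : |x 2| ≤ 1 / (8 * (l * δ)) := by simpa [rx] using hx 2
    have b0' : |ξ 0| ≤ 3 * l / 2 := by
      have := abs_le.1 b0
      exact abs_le.2 ⟨by linarith, by linarith⟩
    have hpF := pF_bound F δ l hF hδ hl ξ (hNl ξ hξ') b2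
    have m0 : |x 0 * ξ 0| ≤ 3 / 16 := by
      rw [abs_mul]
      refine (mul_le_mul x0 b0' (abs_nonneg _) (by positivity)).trans (le_of_eq ?_)
      field_simp; norm_num
    have m1 : |x 1 * ξ 1| ≤ 1 / 16 := by
      rw [abs_mul]
      refine (mul_le_mul x1 b1 (abs_nonneg _) (by positivity)).trans (le_of_eq ?_)
      field_simp; norm_num
    have m2 : |x 2 * ξ 2| ≤ 1 / 16 := by
      rw [abs_mul]
      refine (mul_le_mul x2 b2 (abs_nonneg _) (by positivity)).trans (le_of_eq ?_)
      field_simp; norm_num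
    have mt : |t / ε * (pF F ξ - 1 / F)| ≤ 1 / 2 := by
      rw [abs_mul, abs_div, abs_of_pos hε]
      refine (mul_le_mul (div_le_div_of_nonneg_right ht hε.le) hpF (abs_nonneg _)
        (by positivity)).trans (le_of_eq ?_)
      field_simp
    have hinner : ⟪x, ξ⟫ = x 0 * ξ 0 + x 1 * ξ 1 + x 2 * ξ 2 := by
      rw [PiLp.inner_apply, Fin.sum_univ_three]
      simp [mul_comm]
    have e : ⟪x, ξ⟫ + t / ε * pF F ξ - t / ε * (1 / F) =
        x 0 * ξ 0 + x 1 * ξ 1 + x 2 * ξ 2 + t / ε * (pF F ξ - 1 / F) := by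
      rw [hinner]; ring
    simp only [e]
    rw [abs_le] at *
    constructor <;> linarith [m0.1, m0.2, m1.1, m1.2, m2.1, m2.2, mt.1, mt.2]
  -- lower bound for the mixed norm
  have hfinal := (h g).trans (ENNReal.ofReal_le_ofReal
    (mul_le_mul_of_nonneg_left hsob hC.le))
  rw [← ENNReal.ofReal_le_ofReal_iff (by positivity)]
  refine le_trans ?_ hfinal
  unfold mixedNorm
  have hT : 0 ≤ ε * F / (F ^ 2 - 1) / δ ^ 2 := by positivity
  rw [← ENNReal.ofReal_rpow_of_nonneg (by positivity) (by positivity)]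
  refine ENNReal.rpow_le_rpow ?_ (by positivity)
  rw [ENNReal.ofReal_mul (by positivity)]
  have hv : ENNReal.ofReal (2 * (ε * F / (F ^ 2 - 1) / δ ^ 2)) =
      volume (Set.Icc (-(ε * F / (F ^ 2 - 1) / δ ^ 2)) (ε * F / (F ^ 2 - 1) / δ ^ 2)) := by
    rw [Real.volume_Icc]; congr 1; ring
  rw [hv, ← setLIntegral_const]
  refine le_trans (setLIntegral_mono' measurableSet_Icc fun t ht => ?_)
    (setLIntegral_le_lintegral _ _)
  rw [← ENNReal.ofReal_rpow_of_nonneg (by positivity) (by positivity)]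
  refine ENNReal.rpow_le_rpow ?_ (by positivity)
  rw [ENNReal.ofReal_mul (by positivity), ← hvolx, ← setLIntegral_const]
  refine le_trans (setLIntegral_mono' (sbox_meas _ _) fun x hx => ?_)
    (setLIntegral_le_lintegral _ _)
  rw [← ENNReal.ofReal_rpow_of_nonneg (by positivity) (by positivity)]
  refine ENNReal.rpow_le_rpow ?_ (by positivity)
  have := hpt t (abs_le.2 ht) x hx
  rw [← enorm_eq_nnnorm, ← ofReal_norm]
  exact ENNReal.ofReal_le_ofReal this

lemma affine_zero (a M : ℝ) (h : ∀ L : ℝ, a * L ≤ M) : a = 0 := by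
  by_contra ha
  have := h ((M + 1) / a)
  rw [mul_div_cancel₀ _ ha] at this
  linarith

lemma affine_nonneg (a M : ℝ) (h : ∀ L : ℝ, L ≤ 0 → a * L ≤ M) : 0 ≤ a := by
  by_contra ha
  push Not at ha
  have hM : 0 ≤ M := by simpa using h 0 le_rfl
  have := h ((M + 1) / a) (div_nonpos_of_nonneg_of_nonpos (by linarith) ha.le)
  rw [mul_div_cancel₀ _ ha.ne] at this
  linarith

theorem strichartz_primitive_sharpness (ε F : ℝ) (hε : 0 < ε) (hF : 1 < F)
    (p q s : ℝ) (hp : 2 ≤ p) (hq : 2 ≤ q)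
    (h : ∃ C : ℝ, 0 < C ∧ ∀ g : SchwartzMap (EuclideanSpace ℝ (Fin 3)) ℂ,
      mixedNorm p q (fun t x =>
          ∫ ξ : EuclideanSpace ℝ (Fin 3),
            Complex.exp (Complex.I * Complex.ofReal (⟪x, ξ⟫ + (t / ε) * pF F ξ)) *
              fourierTf (fun y => g y) ξ)
        ≤ ENNReal.ofReal (C * sobolevNorm s (fun y => g y))) :
    2 / p + 1 / q ≤ 1 / 2 ∧ s = 3 * (1 / 2 - 1 / q) := by
  obtain ⟨C, hC, h⟩ := h
  have hF1 : 0 < F ^ 2 - 1 := by nlinarith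
  have hFp : 0 < F := by linarith
  have hp0 : 0 < p := by linarith
  have hq0 : 0 < q := by linarith
  obtain ⟨M, hM⟩ : ∃ M : ℝ, ∀ L d : ℝ, d ≤ 0 →
      (3 * (1 / 2 - 1 / q) - s) * L + (1 / 2 - 1 / q - 2 / p) * d ≤ M := by
    refine ⟨Real.log C + (Real.log 2 * |2 * s|) / 2 + Real.log 16 + Real.log 64 / q
      - Real.log (2 * (ε * F / (F ^ 2 - 1))) / p, fun L d hd => ?_⟩
    have key := main_ineq ε F hε hF p q s C hp hq hC h (Real.exp L) (Real.exp d)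
      (Real.exp (3 * L + d)) (Real.exp_pos _) (Real.exp_pos _) (Real.exp_le_one_iff.2 hd)
      (by rw [Real.exp_add, ← Real.exp_nat_mul]; norm_num)
    have hτ : 0 < 2 * (ε * F / (F ^ 2 - 1)) := by positivity
    rw [← mul_div_assoc 2 (ε * F / (F ^ 2 - 1))] at key
    generalize 2 * (ε * F / (F ^ 2 - 1)) = τ at *
    have k2 := Real.log_le_log (by positivity) key
    rw [Real.log_rpow (by positivity), Real.log_mul (by positivity) (by positivity),
      Real.log_rpow (by positivity), Real.log_mul (by positivity) (by positivity),
      Real.log_rpow (by positivity), Real.log_div (by positivity) (by positivity),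
      Real.log_div (by positivity) (by positivity), Real.log_inv, Real.log_exp,
      Real.log_div hτ.ne' (by positivity), Real.log_pow, Real.log_exp,
      Real.log_mul (by positivity) (by positivity), Real.log_rpow (by positivity),
      Real.log_mul (by positivity) (by positivity), Real.log_mul (by positivity) (by positivity),
      Real.log_exp, Real.log_exp, Real.log_rpow (by positivity), Real.log_exp] at k2
    have e : 1 / p * (p / q * (q * (3 * L + d - Real.log 16) + (-(3 * L + d) - Real.log 64)) +
        (Real.log (τ) - ((2 : ℕ) : ℝ) * d)) =
        (3 * L + d - Real.log 16) + (-(3 * L + d) - Real.log 64) / q +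
        (Real.log (τ) - 2 * d) / p := by
      push_cast
      field_simp
    rw [e] at k2
    have e2 : (3 * (1 / 2 - 1 / q) - s) * L + (1 / 2 - 1 / q - 2 / p) * d =
      ((3 * L + d - Real.log 16) + (-(3 * L + d) - Real.log 64) / q +
        (Real.log (τ) - 2 * d) / p) + Real.log 16 + Real.log 64 / q
        - Real.log (τ) / p - s * L - (3 * L + d) / 2 := by
      ring
    rw [e2]
    linarith
  have c1 := affine_zero _ M (fun L => by have := hM L 0 le_rfl; rwa [mul_zero, add_zero] at this)
  have c2 := affine_nonneg _ M (fun d hd => by have := hM 0 d hd; rwa [mul_zero, zero_add] at this)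
  exact ⟨by linarith, by linarith⟩

end
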